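/- arXiv:1404.6592 — 2 statements merged into one kernel-verified Lean document; each statement's English description precedes it below -/
import Mathlib

section
/- For unit vectors A, B, C in ℝ³, (det M(A,B,C))² + (1 + A·B + B·C + C·A)² = 2(1 + A·B)(1 + B·C)(1 + C·A). -/
open Matrix

/-- The 3×3 matrix whose columns are the vectors A, B, C. -/
def colMat (A B C : Fin 3 → ℝ) : Matrix (Fin 3) (Fin 3) ℝ :=
  Matrix.of fun i j => ![A, B, C] j i

/-- The square of the determinant of three vectors in `ℝ³` is their Gram determinant. -/
lemma colMat_det_sq (A B C : Fin 3 → ℝ) :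
    (colMat A B C).det ^ 2 =
      (A ⬝ᵥ A) * (B ⬝ᵥ B) * (C ⬝ᵥ C) + 2 * (A ⬝ᵥ B) * (B ⬝ᵥ C) * (C ⬝ᵥ A)
        - (A ⬝ᵥ A) * (B ⬝ᵥ C) ^ 2 - (B ⬝ᵥ B) * (C ⬝ᵥ A) ^ 2 - (C ⬝ᵥ C) * (A ⬝ᵥ B) ^ 2 := by
  simp [colMat, Matrix.det_fin_three, dotProduct, Fin.sum_univ_three]
  ring

theorem tuynman_euler_pythagoras (A B C : Fin 3 → ℝ)
    (hA : A ⬝ᵥ A = 1) (hB : B ⬝ᵥ B = 1) (hC : C ⬝ᵥ C = 1) :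
    ((colMat A B C).det) ^ 2 + (1 + A ⬝ᵥ B + B ⬝ᵥ C + C ⬝ᵥ A) ^ 2
      = 2 * (1 + A ⬝ᵥ B) * (1 + B ⬝ᵥ C) * (1 + C ⬝ᵥ A) := by
  rw [colMat_det_sq, hA, hB, hC]
  ring
end

section
/- Let A, B, C be unit vectors in ℝ³, positively oriented (det M(A,B,C) > 0) and pairwise non-antipodal, and let X be a unit vector interior to the spherical triangle ABC. Then the oriented areas satisfy S(B,C,X) + S(C,A,X) + S(A,B,X) = S(A,B,C), where for each triangle the area S ∈ (0, 2π) is determined by cos(S/2) = (1 + sum of pairwise dot products)/√(2·product of (1 + pairwise dot products)) and sin(S/2) = det M/√(same denominator). -/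
open Matrix

/-- The Euler cosine numerator of the spherical triangle UVW. -/
def eulerNum (U V W : Fin 3 → ℝ) : ℝ := 1 + U ⬝ᵥ V + V ⬝ᵥ W + W ⬝ᵥ U

/-- The common denominator in the Euler and Tuynman formulas. -/
noncomputable def denom (U V W : Fin 3 → ℝ) : ℝ :=
  Real.sqrt (2 * (1 + U ⬝ᵥ V) * (1 + V ⬝ᵥ W) * (1 + W ⬝ᵥ U))

/-- The area `S ∈ (0, 2π)` of the spherical triangle UVW is characterized by the
Euler and Tuynman formulas. -/
def IsArea (U V W : Fin 3 → ℝ) (S : ℝ) : Prop :=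
  S ∈ Set.Ioo 0 (2 * Real.pi) ∧
    Real.cos (S / 2) = eulerNum U V W / denom U V W ∧
    Real.sin (S / 2) = (colMat U V W).det / denom U V W

/-- Product of two determinants as a Gram determinant. -/
lemma det_colMat_mul_det_colMat (U V W P Q R : Fin 3 → ℝ) :
    (colMat U V W).det * (colMat P Q R).det =
      U ⬝ᵥ P * (V ⬝ᵥ Q * (W ⬝ᵥ R) - V ⬝ᵥ R * (W ⬝ᵥ Q))
        - U ⬝ᵥ Q * (V ⬝ᵥ P * (W ⬝ᵥ R) - V ⬝ᵥ R * (W ⬝ᵥ P))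
        + U ⬝ᵥ R * (V ⬝ᵥ P * (W ⬝ᵥ Q) - V ⬝ᵥ Q * (W ⬝ᵥ P)) := by
  simp only [colMat, det_fin_three, dotProduct, Fin.sum_univ_three, of_apply, cons_val]
  ring

/-- Cramer's rule for `X` in terms of `A, B, C`, tested against a vector `Y`. -/
lemma det_colMat_mul_dotProduct (A B C X Y : Fin 3 → ℝ) :
    (colMat A B C).det * (X ⬝ᵥ Y) =
      (colMat B C X).det * (A ⬝ᵥ Y) + (colMat C A X).det * (B ⬝ᵥ Y)
        + (colMat A B X).det * (C ⬝ᵥ Y) := by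
  simp only [colMat, det_fin_three, dotProduct, Fin.sum_univ_three, of_apply, cons_val]
  ring

lemma denom_pos {U V W : Fin 3 → ℝ} (hUV : U ⬝ᵥ V > -1) (hVW : V ⬝ᵥ W > -1)
    (hWU : W ⬝ᵥ U > -1) : 0 < denom U V W := by
  have h₁ : 0 < 1 + U ⬝ᵥ V := by linarith
  have h₂ : 0 < 1 + V ⬝ᵥ W := by linarith
  have h₃ : 0 < 1 + W ⬝ᵥ U := by linarith
  exact Real.sqrt_pos.2 (by positivity)

lemma denom_sq {U V W : Fin 3 → ℝ} (hUV : U ⬝ᵥ V > -1) (hVW : V ⬝ᵥ W > -1)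
    (hWU : W ⬝ᵥ U > -1) :
    denom U V W ^ 2 = 2 * (1 + U ⬝ᵥ V) * (1 + V ⬝ᵥ W) * (1 + W ⬝ᵥ U) := by
  have h₁ : 0 < 1 + U ⬝ᵥ V := by linarith
  have h₂ : 0 < 1 + V ⬝ᵥ W := by linarith
  have h₃ : 0 < 1 + W ⬝ᵥ U := by linarith
  exact Real.sq_sqrt (by positivity)

/-- A subtriangle cut off by `X` whose determinant is at most the sum of the other three has
at most the area of the whole triangle. -/
lemma IsArea.le_of_det_le {A B C X : Fin 3 → ℝ} {S S₁ : ℝ}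
    (hB : B ⬝ᵥ B = 1) (hC : C ⬝ᵥ C = 1)
    (hAB : A ⬝ᵥ B > -1) (hBC : B ⬝ᵥ C > -1) (hCA : C ⬝ᵥ A > -1)
    (hBX : B ⬝ᵥ X > -1) (hCX : C ⬝ᵥ X > -1)
    (hS : IsArea A B C S) (hS₁ : IsArea B C X S₁)
    (hdet : (colMat B C X).det ≤
      (colMat A B C).det + (colMat C A X).det + (colMat A B X).det) : S₁ ≤ S := by
  obtain ⟨⟨h0, hlt⟩, hc, hs⟩ := hS
  obtain ⟨⟨h0', hlt'⟩, hc', hs'⟩ := hS₁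
  have hd := denom_pos hAB hBC hCA
  have hd₁ : 0 < denom B C X := denom_pos hBC hCX (by rwa [dotProduct_comm])
  have key : eulerNum B C X * (colMat A B C).det - (colMat B C X).det * eulerNum A B C =
      (1 + B ⬝ᵥ C) * ((colMat A B C).det + (colMat C A X).det + (colMat A B X).det
        - (colMat B C X).det) := by
    have e₁ := det_colMat_mul_dotProduct A B C X B
    have e₂ := det_colMat_mul_dotProduct A B C X C
    rw [hB, dotProduct_comm C B] at e₁
    rw [hC, dotProduct_comm A C, dotProduct_comm X C] at e₂
    simp only [eulerNum]
    linear_combination e₁ + e₂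
  have hsin : 0 ≤ Real.sin (S / 2 - S₁ / 2) := by
    rw [Real.sin_sub, hc, hs, hc', hs']
    have : (colMat A B C).det / denom A B C * (eulerNum B C X / denom B C X)
        - eulerNum A B C / denom A B C * ((colMat B C X).det / denom B C X) =
        (1 + B ⬝ᵥ C) * ((colMat A B C).det + (colMat C A X).det + (colMat A B X).det
          - (colMat B C X).det) / (denom A B C * denom B C X) := by
      rw [← key]; field_simp
    rw [this]
    exact div_nonneg (mul_nonneg (by linarith) (by linarith)) (by positivity)
  by_contra! hlt₁
  have := Real.sin_neg_of_neg_of_neg_pi_lt (x := S / 2 - S₁ / 2) (by linarith) (by linarith)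
  linarith

/-- The half areas satisfy `S₁ / 2 + S₂ / 2 ≡ S / 2 - S₃ / 2` modulo `2 * π`: both sides are the
half area of the quadrilateral with vertices `X, B, C, A`. -/
lemma cos_half_areas_eq_one {A B C X : Fin 3 → ℝ} {S S₁ S₂ S₃ : ℝ}
    (hA : A ⬝ᵥ A = 1) (hB : B ⬝ᵥ B = 1) (hC : C ⬝ᵥ C = 1) (hX : X ⬝ᵥ X = 1)
    (hAB : A ⬝ᵥ B > -1) (hBC : B ⬝ᵥ C > -1) (hCA : C ⬝ᵥ A > -1)
    (hAX : A ⬝ᵥ X > -1) (hBX : B ⬝ᵥ X > -1) (hCX : C ⬝ᵥ X > -1)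
    (hS : IsArea A B C S) (hS₁ : IsArea B C X S₁)
    (hS₂ : IsArea C A X S₂) (hS₃ : IsArea A B X S₃) :
    Real.cos ((S₁ / 2 + S₂ / 2) - (S / 2 - S₃ / 2)) = 1 := by
  obtain ⟨-, hc, hs⟩ := hS
  obtain ⟨-, hc₁, hs₁⟩ := hS₁
  obtain ⟨-, hc₂, hs₂⟩ := hS₂
  obtain ⟨-, hc₃, hs₃⟩ := hS₃
  have hXA : X ⬝ᵥ A > -1 := by rwa [dotProduct_comm]
  have hXB : X ⬝ᵥ B > -1 := by rwa [dotProduct_comm]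
  have hXC : X ⬝ᵥ C > -1 := by rwa [dotProduct_comm]
  have hd := denom_pos hAB hBC hCA
  have hd₁ := denom_pos hBC hCX hXB
  have hd₂ := denom_pos hCA hAX hXC
  have hd₃ := denom_pos hAB hBX hXA
  have hr : 0 < 1 + A ⬝ᵥ B := by linarith
  have hu : 0 < 1 + C ⬝ᵥ X := by linarith
  have hden : denom B C X * denom C A X * (1 + A ⬝ᵥ B) =
      denom A B C * denom A B X * (1 + C ⬝ᵥ X) := by
    rw [← sq_eq_sq₀ (by positivity) (by positivity)]
    simp only [mul_pow, denom_sq hAB hBC hCA, denom_sq hBC hCX hXB, denom_sq hCA hAX hXC,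
      denom_sq hAB hBX hXA, dotProduct_comm X]
    ring
  have hsin : ((colMat B C X).det * eulerNum C A X + eulerNum B C X * (colMat C A X).det)
        * (1 + A ⬝ᵥ B) =
      ((colMat A B C).det * eulerNum A B X - eulerNum A B C * (colMat A B X).det)
        * (1 + C ⬝ᵥ X) := by
    have eA := det_colMat_mul_dotProduct A B C X A
    have eB := det_colMat_mul_dotProduct A B C X B
    have eC := det_colMat_mul_dotProduct A B C X C
    have eX := det_colMat_mul_dotProduct A B C X X
    simp only [hA, hB, hC, hX, dotProduct_comm X, dotProduct_comm B A, dotProduct_comm C B,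
      dotProduct_comm A C] at eA eB eC eX
    simp only [eulerNum, dotProduct_comm X]
    linear_combination -(1 + A ⬝ᵥ B) * (eC + eX) - (1 + C ⬝ᵥ X) * (eA + eB)
  have hcos : (eulerNum B C X * eulerNum C A X - (colMat B C X).det * (colMat C A X).det)
        * (1 + A ⬝ᵥ B) =
      (eulerNum A B C * eulerNum A B X + (colMat A B C).det * (colMat A B X).det)
        * (1 + C ⬝ᵥ X) := by
    simp only [det_colMat_mul_det_colMat, eulerNum, hA, hB, hC, hX, dotProduct_comm X,
      dotProduct_comm B A, dotProduct_comm C B]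
    ring
  have hsin' : Real.sin (S₁ / 2 + S₂ / 2) = Real.sin (S / 2 - S₃ / 2) := by
    rw [Real.sin_add, Real.sin_sub, hc, hs, hc₁, hs₁, hc₂, hs₂, hc₃, hs₃]
    simp only [div_mul_div_comm, ← add_div, ← sub_div]
    rw [div_eq_div_iff (by positivity) (by positivity)]
    refine mul_right_cancel₀ (mul_pos hr hu).ne' ?_
    linear_combination (denom A B C * denom A B X * (1 + C ⬝ᵥ X)) * hsin
      - (1 + C ⬝ᵥ X) * ((colMat A B C).det * eulerNum A B X
        - eulerNum A B C * (colMat A B X).det) * hden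
  have hcos' : Real.cos (S₁ / 2 + S₂ / 2) = Real.cos (S / 2 - S₃ / 2) := by
    rw [Real.cos_add, Real.cos_sub, hc, hs, hc₁, hs₁, hc₂, hs₂, hc₃, hs₃]
    simp only [div_mul_div_comm, ← add_div, ← sub_div]
    rw [div_eq_div_iff (by positivity) (by positivity)]
    refine mul_right_cancel₀ (mul_pos hr hu).ne' ?_
    linear_combination (denom A B C * denom A B X * (1 + C ⬝ᵥ X)) * hcos
      - (1 + C ⬝ᵥ X) * (eulerNum A B C * eulerNum A B X
        + (colMat A B C).det * (colMat A B X).det) * hden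
  rw [Real.cos_sub, hsin', hcos', ← sq, ← sq, Real.cos_sq_add_sin_sq]

theorem subtriangle_areas_sum (A B C X : Fin 3 → ℝ) (S S₁ S₂ S₃ : ℝ)
    (hA : A ⬝ᵥ A = 1) (hB : B ⬝ᵥ B = 1) (hC : C ⬝ᵥ C = 1) (hX : X ⬝ᵥ X = 1)
    -- positive orientation
    (hpos : (colMat A B C).det > 0)
    -- pairwise non-antipodality
    (hAB : A ⬝ᵥ B > -1) (hBC : B ⬝ᵥ C > -1) (hCA : C ⬝ᵥ A > -1)
    (hAX : A ⬝ᵥ X > -1) (hBX : B ⬝ᵥ X > -1) (hCX : C ⬝ᵥ X > -1)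
    -- X is interior to the spherical triangle ABC
    (hint₁ : (colMat B C X).det > 0) (hint₂ : (colMat C A X).det > 0)
    (hint₃ : (colMat A B X).det > 0)
    -- areas of ABC, BCX, CAX, ABX
    (hS : IsArea A B C S) (hS₁ : IsArea B C X S₁)
    (hS₂ : IsArea C A X S₂) (hS₃ : IsArea A B X S₃) :
    S₁ + S₂ + S₃ = S := by
  have hone := cos_half_areas_eq_one hA hB hC hX hAB hBC hCA hAX hBX hCX hS hS₁ hS₂ hS₃
  -- At most one subtriangle can violate the determinant bound of `IsArea.le_of_det_le`.
  have hle : S₁ ≤ S ∨ S₂ ≤ S := by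
    rcases le_total (colMat B C X).det (colMat C A X).det with h | h
    · exact .inl (hS.le_of_det_le hB hC hAB hBC hCA hBX hCX hS₁ (by linarith))
    · have hcyc : (colMat B C A).det = (colMat A B C).det := by
        simp only [colMat, det_fin_three, of_apply, cons_val]
        ring
      have hS' : IsArea B C A S := by
        have hE : eulerNum B C A = eulerNum A B C := by simp only [eulerNum]; ring
        have hD : denom B C A = denom A B C := by simp only [denom]; congr 1; ring
        simpa only [IsArea, hE, hD, hcyc] using hS
      exact .inr (hS'.le_of_det_le hC hA hBC hCA hAB hCX hAX hS₂ (by linarith))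
  obtain ⟨n, hn⟩ := (Real.cos_eq_one_iff _).1 hone
  obtain ⟨⟨h0, hlt⟩, -⟩ := hS
  obtain ⟨⟨h0₁, hlt₁⟩, -⟩ := hS₁
  obtain ⟨⟨h0₂, hlt₂⟩, -⟩ := hS₂
  obtain ⟨⟨h0₃, hlt₃⟩, -⟩ := hS₃
  have hπ := Real.pi_pos
  have hn₁ : n < 1 := by
    have : (n : ℝ) < 1 := by
      rcases hle with h | h <;> nlinarith
    exact_mod_cast this
  have hn₂ : -1 < n := by
    have : (-1 : ℝ) < n := by nlinarith
    exact_mod_cast this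
  obtain rfl : n = 0 := by omega
  push_cast at hn
  linarith
end
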